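/- Assume (P0), (P1) and (P2). Then there exists a constant C such that for all μ, ν ∈ P(E) and every bounded measurable f : E → ℝ, ‖Q_μf − Q_νf‖_∞ ≤ C‖f‖_∞‖μ − ν‖_TV, where Q_μf(x) = Σ_{n≥0}(𝕂_μ^n f(x) − Π_μ(f)) is the solution of the Poisson equation for 𝕂_μ. -/

import Mathlib

open MeasureTheory Filter Topology
open scoped ENNReal NNReal

noncomputable section

namespace QSD

variable {E : Type*}

/-- `n`-fold iterate of a sub-Markov kernel given as a measure-valued map:
`kIter K 0 x = δ_x` and `kIter K (n+1) x = (K x).bind (kIter K n)`. -/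
def kIter [MeasurableSpace E] (K : E → Measure E) : ℕ → E → Measure E
  | 0, x => Measure.dirac x
  | n + 1, x => (K x).bind (kIter K n)

/-- Total variation distance between two measures: supremum over measurable sets
of the absolute difference of the masses. -/
def tvDist [MeasurableSpace E] (μ ν : Measure E) : ℝ :=
  ⨆ A : {s : Set E // MeasurableSet s}, |(μ (A : Set E)).toReal - (ν (A : Set E)).toReal|

/-- The kernel `A_μ(x,·) = Σ_{n≥0} K_{μ,∂}^n(x,·)`. -/
def Aker [MeasurableSpace E] (K : E → Measure E) (x : E) : Measure E :=
  Measure.sum fun n => kIter K n x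

/-- `Π_μ = μ A_μ / (μ A_μ)(E)`. -/
def Pim [MeasurableSpace E] (K : E → Measure E) (μ : Measure E) : Measure E :=
  ((μ.bind (Aker K)) Set.univ)⁻¹ • μ.bind (Aker K)

/-- The kernel with redistribution (rebirth) `𝕂_μ(x,·) = K_{μ,∂}(x,·) + δ_μ(x)·μ(·)`,
where `δ_μ(x) = 1 - K_{μ,∂}(x,E)`. -/
def Kret [MeasurableSpace E] (K : E → Measure E) (μ : Measure E) (x : E) : Measure E :=
  K x + (1 - K x Set.univ) • μ

/-- Iterated application of a family of kernels to the constant function `𝟙`: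
`chainV K [μ₁,…,μ_k] x = (K_{μ₁}(K_{μ₂}(⋯(K_{μ_k} 𝟙)⋯)))(x)`. -/
def chainV {V : Type*} [MeasurableSpace V] {I : Type*} (K : I → V → Measure V) :
    List I → V → ℝ≥0∞
  | [], _ => 1
  | μ :: L, x => ∫⁻ y, chainV K L y ∂(K μ x)

end QSD

open QSD

/-- The candidate solution of the Poisson equation:
`Q_μ f(x) = Σ_{n≥0} (𝕂_μ^n f(x) − Π_μ(f))`. -/
def Qfun {E : Type*} [MeasurableSpace E]
    (Kb : ProbabilityMeasure E → E → Measure E)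
    (Pi : ProbabilityMeasure E → ProbabilityMeasure E)
    (μ : ProbabilityMeasure E) (f : E → ℝ) (x : E) : ℝ :=
  ∑' n : ℕ, (∫ y, f y ∂(kIter (Kb μ) n x) - ∫ y, f y ∂(Pi μ : Measure E))

namespace QSD

variable {E : Type*}

/-- The oscillation of `g` is at most `D`. -/
def OscLE (g : E → ℝ) (D : ℝ) : Prop := ∀ x y, g x - g y ≤ D

lemma OscLE.nonneg [hE : Nonempty E] {g : E → ℝ} {D : ℝ} (h : OscLE g D) : 0 ≤ D := by
  obtain ⟨x⟩ := hE
  simpa using h x x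

lemma OscLE.add {f g : E → ℝ} {D D' : ℝ} (hf : OscLE f D) (hg : OscLE g D') :
    OscLE (fun x ↦ f x + g x) (D + D') := fun x y ↦ by
  have := hf x y
  have := hg x y
  linarith

lemma OscLE.sub_const {f : E → ℝ} {D : ℝ} (hf : OscLE f D) (c : ℝ) :
    OscLE (fun x ↦ f x - c) D := fun x y ↦ by simpa using hf x y

lemma OscLE.mono {f : E → ℝ} {D D' : ℝ} (hf : OscLE f D) (h : D ≤ D') : OscLE f D' :=
  fun x y ↦ (hf x y).trans h

lemma OscLE.sum {ι : Type*} {f : ι → E → ℝ} {D : ι → ℝ} (s : Finset ι)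
    (h : ∀ i ∈ s, OscLE (f i) (D i)) : OscLE (fun x ↦ ∑ i ∈ s, f i x) (∑ i ∈ s, D i) :=
  fun x y ↦ by
    rw [← Finset.sum_sub_distrib]
    exact Finset.sum_le_sum fun i hi ↦ h i hi x y

lemma oscLE_of_abs_le {f : E → ℝ} {M : ℝ} (h : ∀ x, |f x| ≤ M) : OscLE f (2 * M) :=
  fun x y ↦ by
    have := abs_le.1 (h x)
    have := abs_le.1 (h y)
    linarith

lemma OscLE.exists_lower [Nonempty E] {g : E → ℝ} {D : ℝ} (h : OscLE g D) :
    ∃ m, ∀ x, m ≤ g x ∧ g x ≤ m + D := by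
  have hb : BddBelow (Set.range g) := by
    obtain ⟨x₀⟩ := ‹Nonempty E›
    refine ⟨g x₀ - D, ?_⟩
    rintro _ ⟨x, rfl⟩
    have := h x₀ x
    linarith
  refine ⟨⨅ x, g x, fun x ↦ ⟨ciInf_le hb x, ?_⟩⟩
  have : g x - D ≤ ⨅ y, g y := le_ciInf fun y ↦ by
    have := h x y
    linarith
  linarith

variable [MeasurableSpace E]

lemma OscLE.integrable {g : E → ℝ} {D : ℝ} (h : OscLE g D) (hg : Measurable g)
    (μ : Measure E) [IsFiniteMeasure μ] : Integrable g μ := by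
  rcases isEmpty_or_nonempty E with hE | hE
  · exact Integrable.of_isEmpty
  obtain ⟨m, hm⟩ := h.exists_lower
  refine Integrable.of_bound hg.aestronglyMeasurable (|m| + |D|) (.of_forall fun x ↦ ?_)
  rw [Real.norm_eq_abs, abs_le]
  have := hm x
  have := neg_abs_le m
  have := le_abs_self m
  have := le_abs_self D
  have := abs_nonneg D
  constructor <;> linarith

lemma abs_measureReal_sub_le_tvDist (μ ν : Measure E) [IsProbabilityMeasure μ]
    [IsProbabilityMeasure ν] {s : Set E} (hs : MeasurableSet s) :
    |μ.real s - ν.real s| ≤ tvDist μ ν := by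
  have hb : BddAbove (Set.range fun A : {s : Set E // MeasurableSet s} ↦
      |(μ (A : Set E)).toReal - (ν (A : Set E)).toReal|) := by
    refine ⟨1, ?_⟩
    rintro _ ⟨A, rfl⟩
    have h1 : μ.real (A : Set E) ≤ 1 := measureReal_le_one
    have h2 : ν.real (A : Set E) ≤ 1 := measureReal_le_one
    have h3 : 0 ≤ μ.real (A : Set E) := measureReal_nonneg
    have h4 : 0 ≤ ν.real (A : Set E) := measureReal_nonneg
    exact abs_le.2 ⟨by change _ ≤ μ.real (A : Set E) - ν.real (A : Set E); linarith,
      by change μ.real (A : Set E) - ν.real (A : Set E) ≤ _; linarith⟩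
  exact le_ciSup hb ⟨s, hs⟩

lemma abs_integral_sub_integral_le_tvDist (μ ν : Measure E) [IsProbabilityMeasure μ]
    [IsProbabilityMeasure ν] {g : E → ℝ} {D : ℝ} (hg : Measurable g) (h : OscLE g D) :
    |∫ y, g y ∂μ - ∫ y, g y ∂ν| ≤ D * tvDist μ ν := by
  have : Nonempty E := nonempty_of_isProbabilityMeasure μ
  obtain ⟨m, hm⟩ := h.exists_lower
  have hD := h.nonneg
  have layer (ρ : Measure E) [IsProbabilityMeasure ρ] :
      ∫ y, g y ∂ρ = m + ∫ t in Set.Ioc 0 D, ρ.real {a | t ≤ g a - m} := by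
    rw [← Integrable.integral_eq_integral_Ioc_meas_le
      ((h.sub_const m).integrable (hg.sub_const m) ρ)
      (.of_forall fun x ↦ by have := hm x; simp; linarith)
      (.of_forall fun x ↦ by have := hm x; simp; linarith),
      integral_sub (h.integrable hg ρ) (integrable_const m)]
    simp
  have hint (ρ : Measure E) [IsProbabilityMeasure ρ] :
      IntegrableOn (fun t ↦ ρ.real {a | t ≤ g a - m}) (Set.Ioc 0 D) := by
    have : Antitone fun t ↦ ρ.real {a | t ≤ g a - m} := fun s t hst ↦
      measureReal_mono fun a ha ↦ hst.trans ha
    exact (this.locallyIntegrable.integrableOn_isCompact isCompact_Icc).mono_set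
      Set.Ioc_subset_Icc_self
  rw [layer μ, layer ν, add_sub_add_left_eq_sub, ← integral_sub (hint μ) (hint ν)]
  have := norm_setIntegral_le_of_norm_le_const (μ := volume) (s := Set.Ioc 0 D)
    (f := fun t ↦ μ.real {a | t ≤ g a - m} - ν.real {a | t ≤ g a - m}) (C := tvDist μ ν)
    (by simp) (fun t _ ↦ abs_measureReal_sub_le_tvDist μ ν
      (measurableSet_le measurable_const (hg.sub_const m)))
  simpa [hD, mul_comm] using this

lemma integral_bind_eq {m : Measure E} [IsProbabilityMeasure m] {K : E → Measure E}
    (hK : Measurable K) (hP : ∀ x, IsProbabilityMeasure (K x)) {g : E → ℝ} {D : ℝ}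
    (hg : Measurable g) (h : OscLE g D) :
    ∫ y, g y ∂(m.bind K) = ∫ x, ∫ y, g y ∂(K x) ∂m := by
  have := isProbabilityMeasure_bind hK.aemeasurable (.of_forall hP) (m := m)
  have := ProbabilityTheory.Kernel.integral_comp (κ := ProbabilityTheory.Kernel.const Unit m)
    (η := ⟨K, hK⟩) (a := ()) (f := g)
  simp only [ProbabilityTheory.Kernel.comp_apply, ProbabilityTheory.Kernel.const_apply] at this
  exact this (h.integrable hg _)

variable {K : E → Measure E}

lemma measurable_kIter (hK : Measurable K) (n : ℕ) : Measurable (kIter K n) := by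
  induction n with
  | zero => exact Measure.measurable_dirac
  | succ n ih => exact (Measure.measurable_bind' ih).comp hK

lemma isProbabilityMeasure_kIter (hK : Measurable K) (hP : ∀ x, IsProbabilityMeasure (K x))
    (n : ℕ) (x : E) : IsProbabilityMeasure (kIter K n x) := by
  induction n generalizing x with
  | zero => exact Measure.dirac.isProbabilityMeasure
  | succ n ih =>
    exact isProbabilityMeasure_bind (measurable_kIter hK n).aemeasurable (.of_forall ih)

lemma kIter_one : kIter K 1 = K := by
  funext x
  exact Measure.bind_dirac

lemma kIter_add (hK : Measurable K) (m n : ℕ) (x : E) :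
    kIter K (m + n) x = (kIter K m x).bind (kIter K n) := by
  induction m generalizing x with
  | zero => simp [kIter, Measure.dirac_bind (measurable_kIter hK n)]
  | succ m ih =>
    rw [Nat.succ_add, kIter, kIter, Measure.bind_bind (measurable_kIter hK m).aemeasurable
      (measurable_kIter hK n).aemeasurable]
    exact congrArg _ (funext ih)

/-- The action of the `n`-th iterate of `K` on functions. -/
def kOp (K : E → Measure E) (n : ℕ) (g : E → ℝ) (x : E) : ℝ := ∫ y, g y ∂(kIter K n x)

lemma measurable_kOp (hK : Measurable K) (hP : ∀ x, IsProbabilityMeasure (K x)) (n : ℕ)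
    {g : E → ℝ} (hg : Measurable g) : Measurable (kOp K n g) := by
  let κ : ProbabilityTheory.Kernel E E := ⟨kIter K n, measurable_kIter hK n⟩
  have : ProbabilityTheory.IsMarkovKernel κ := ⟨isProbabilityMeasure_kIter hK hP n⟩
  exact (hg.stronglyMeasurable.integral_kernel (κ := κ)).measurable

lemma kOp_zero {g : E → ℝ} (hg : Measurable g) (x : E) : kOp K 0 g x = g x :=
  integral_dirac' g x hg.stronglyMeasurable

lemma kOp_one (g : E → ℝ) (x : E) : kOp K 1 g x = ∫ y, g y ∂(K x) := by
  rw [kOp, kIter_one]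

lemma kOp_kOp (hK : Measurable K) (hP : ∀ x, IsProbabilityMeasure (K x)) (m n : ℕ)
    {g : E → ℝ} {D : ℝ} (hg : Measurable g) (h : OscLE g D) (x : E) :
    kOp K m (kOp K n g) x = kOp K (m + n) g x := by
  have := isProbabilityMeasure_kIter hK hP m x
  rw [kOp, kOp, kIter_add hK, integral_bind_eq (measurable_kIter hK n)
    (isProbabilityMeasure_kIter hK hP n) hg h]
  rfl

lemma kOp_add (hK : Measurable K) (hP : ∀ x, IsProbabilityMeasure (K x)) (n : ℕ)
    {f g : E → ℝ} {D D' : ℝ} (hf : Measurable f) (h : OscLE f D) (hg : Measurable g)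
    (h' : OscLE g D') (x : E) :
    kOp K n (fun y ↦ f y + g y) x = kOp K n f x + kOp K n g x := by
  have := isProbabilityMeasure_kIter hK hP n x
  exact integral_add (h.integrable hf _) (h'.integrable hg _)

lemma kOp_sub (hK : Measurable K) (hP : ∀ x, IsProbabilityMeasure (K x)) (n : ℕ)
    {f g : E → ℝ} {D D' : ℝ} (hf : Measurable f) (h : OscLE f D) (hg : Measurable g)
    (h' : OscLE g D') (x : E) :
    kOp K n (fun y ↦ f y - g y) x = kOp K n f x - kOp K n g x := by
  have := isProbabilityMeasure_kIter hK hP n x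
  exact integral_sub (h.integrable hf _) (h'.integrable hg _)

lemma OscLE.abs_sub_integral_le (μ : Measure E) [IsProbabilityMeasure μ] {g : E → ℝ} {D : ℝ}
    (hg : Measurable g) (h : OscLE g D) (x : E) : |g x - ∫ y, g y ∂μ| ≤ D := by
  have hi := h.integrable hg μ
  have e : g x - ∫ y, g y ∂μ = ∫ y, (g x - g y) ∂μ := by
    rw [integral_sub (integrable_const _) hi]
    simp
  rw [e]
  have := norm_integral_le_of_norm_le_const (μ := μ) (f := fun y ↦ g x - g y) (C := D)
    (.of_forall fun y ↦ abs_le.2 ⟨by have := h y x; linarith, h x y⟩)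
  simpa using this

lemma OscLE.kOp (hK : Measurable K) (hP : ∀ x, IsProbabilityMeasure (K x)) (n : ℕ)
    {g : E → ℝ} {D : ℝ} (hg : Measurable g) (h : OscLE g D) : OscLE (kOp K n g) D := by
  intro x y
  have := isProbabilityMeasure_kIter hK hP n x
  have := isProbabilityMeasure_kIter hK hP n y
  have hx : Nonempty E := ⟨x⟩
  obtain ⟨m, hm⟩ := h.exists_lower
  have h1 : QSD.kOp K n g x ≤ m + D := by
    have := integral_mono (h.integrable hg (kIter K n x)) (integrable_const (m + D))
      fun z ↦ (hm z).2
    simpa [QSD.kOp] using this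
  have h2 : m ≤ QSD.kOp K n g y := by
    have := integral_mono (integrable_const m) (h.integrable hg (kIter K n y))
      fun z ↦ (hm z).1
    simpa [QSD.kOp] using this
  linarith

/-- Doeblin contraction of the oscillation under a minorization condition. -/
lemma OscLE.kOp_of_minorization (hK : Measurable K) (hP : ∀ x, IsProbabilityMeasure (K x))
    {l : ℕ} {ε : ℝ≥0∞} {Ψ : Measure E} (hΨ : IsProbabilityMeasure Ψ)
    (hmin : ∀ (x : E) (A : Set E), MeasurableSet A → ε * Ψ A ≤ kIter K l x A)
    {g : E → ℝ} {D : ℝ} (hg : Measurable g) (h : OscLE g D) :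
    OscLE (QSD.kOp K l g) ((1 - ε.toReal) * D) := by
  intro x y
  have hx : Nonempty E := ⟨x⟩
  obtain ⟨m, hm⟩ := h.exists_lower
  have hle (z : E) : ε • Ψ ≤ kIter K l z := Measure.le_iff.2 fun s hs ↦ by
    simpa using hmin z s hs
  have := isProbabilityMeasure_kIter hK hP l x
  have := isProbabilityMeasure_kIter hK hP l y
  have h1 : ε.toReal * (∫ z, g z ∂Ψ - m) ≤ QSD.kOp K l g y - m := by
    have := integral_mono_measure (f := fun z ↦ g z - m) (hle y)
      (.of_forall fun z ↦ sub_nonneg.2 (hm z).1) ((h.integrable hg _).sub (integrable_const m))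
    rw [integral_smul_measure, integral_sub (h.integrable hg _) (integrable_const m),
      integral_sub (h.integrable hg _) (integrable_const m)] at this
    simpa [QSD.kOp] using this
  have h2 : ε.toReal * (m + D - ∫ z, g z ∂Ψ) ≤ m + D - QSD.kOp K l g x := by
    have := integral_mono_measure (f := fun z ↦ m + D - g z) (hle x)
      (.of_forall fun z ↦ sub_nonneg.2 (hm z).2) ((integrable_const (m + D)).sub
        (h.integrable hg _))
    rw [integral_smul_measure, integral_sub (integrable_const (m + D)) (h.integrable hg _),
      integral_sub (integrable_const (m + D)) (h.integrable hg _)] at this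
    simpa [QSD.kOp] using this
  linarith

lemma OscLE.kOp_pow (hK : Measurable K) (hP : ∀ x, IsProbabilityMeasure (K x))
    {l : ℕ} {ρ : ℝ}
    (hρ : ∀ (g : E → ℝ) (D : ℝ), Measurable g → OscLE g D → OscLE (QSD.kOp K l g) (ρ * D))
    {g : E → ℝ} {D : ℝ} (hg : Measurable g) (h : OscLE g D) (q s : ℕ) :
    OscLE (QSD.kOp K (l * q + s) g) (ρ ^ q * D) := by
  induction q with
  | zero => simpa using h.kOp hK hP s hg
  | succ q ih =>
    have e : QSD.kOp K (l * (q + 1) + s) g = QSD.kOp K l (QSD.kOp K (l * q + s) g) := by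
      funext x
      rw [kOp_kOp hK hP _ _ hg h]
      congr 1
      ring
    rw [e, pow_succ', mul_assoc]
    exact hρ _ _ (measurable_kOp hK hP _ hg) ih

lemma summable_pow_div {ρ : ℝ} (h0 : 0 ≤ ρ) (h1 : ρ < 1) {l : ℕ} (hl : 1 ≤ l) :
    Summable fun n : ℕ ↦ ρ ^ (n / l) := by
  have : NeZero l := ⟨by omega⟩
  have h := (summable_geometric_of_lt_one h0 h1).mul_of_nonneg
    (hasSum_fintype fun _ : Fin l ↦ (1 : ℝ)).summable (fun _ ↦ pow_nonneg h0 _)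
    (fun _ ↦ zero_le_one)
  simpa [Function.comp_def, Nat.divModEquiv] using (Nat.divModEquiv l).summable_iff.2 h

/-- The kernel `K`, with invariant probability `π`, contracts oscillations at rate `r`. -/
structure OscErgodic (K : E → Measure E) (π : Measure E) (r : ℕ → ℝ) : Prop where
  measurable : Measurable K
  isProb : ∀ x, IsProbabilityMeasure (K x)
  isProb_inv : IsProbabilityMeasure π
  invariant : π.bind K = π
  oscLE : ∀ (g : E → ℝ) (D : ℝ), Measurable g → OscLE g D → ∀ n, OscLE (kOp K n g) (r n * D)
  summable : Summable r

/-- The series solution of the Poisson equation. -/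
def poisson (K : E → Measure E) (π : Measure E) (g : E → ℝ) (x : E) : ℝ :=
  ∑' n : ℕ, (kOp K n g x - ∫ y, g y ∂π)

namespace OscErgodic

variable {π : Measure E} {r : ℕ → ℝ} {f g : E → ℝ} {D D' : ℝ}

lemma integral_kOp (H : OscErgodic K π r) (hg : Measurable g) (h : OscLE g D) (n : ℕ) :
    ∫ x, kOp K n g x ∂π = ∫ x, g x ∂π := by
  have := H.isProb_inv
  have hb : π.bind (kIter K n) = π := by
    induction n with
    | zero => exact Measure.bind_dirac
    | succ n ih =>
      rw [show kIter K (n + 1) = fun x ↦ (K x).bind (kIter K n) from rfl,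
        ← Measure.bind_bind H.measurable.aemeasurable
        (measurable_kIter H.measurable n).aemeasurable, H.invariant, ih]
  conv_rhs => rw [← hb]
  exact (integral_bind_eq (measurable_kIter H.measurable n)
    (isProbabilityMeasure_kIter H.measurable H.isProb n) hg h).symm

lemma abs_kOp_sub_le (H : OscErgodic K π r) (hg : Measurable g) (h : OscLE g D) (n : ℕ) (x : E) :
    |kOp K n g x - ∫ y, g y ∂π| ≤ r n * D := by
  have := H.isProb_inv
  rw [← H.integral_kOp hg h n]
  exact (H.oscLE g D hg h n).abs_sub_integral_le π (measurable_kOp H.measurable H.isProb n hg) x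

lemma summable_poisson (H : OscErgodic K π r) (hg : Measurable g) (h : OscLE g D) (x : E) :
    Summable fun n ↦ kOp K n g x - ∫ y, g y ∂π :=
  Summable.of_norm_bounded (H.summable.mul_right D) (H.abs_kOp_sub_le hg h · x)

lemma abs_poisson_le (H : OscErgodic K π r) (hg : Measurable g) (h : OscLE g D) (x : E) :
    |poisson K π g x| ≤ (∑' n, r n) * D := by
  rw [← tsum_mul_right]
  exact tsum_of_norm_bounded (f := fun n ↦ kOp K n g x - ∫ y, g y ∂π)
    (H.summable.mul_right D).hasSum (H.abs_kOp_sub_le hg h · x)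

lemma poisson_add (H : OscErgodic K π r) (hf : Measurable f) (h : OscLE f D)
    (hg : Measurable g) (h' : OscLE g D') (x : E) :
    poisson K π (fun y ↦ f y + g y) x = poisson K π f x + poisson K π g x := by
  have := H.isProb_inv
  rw [poisson, poisson, poisson, ← (H.summable_poisson hf h x).tsum_add
    (H.summable_poisson hg h' x)]
  refine tsum_congr fun n ↦ ?_
  rw [kOp_add H.measurable H.isProb n hf h hg h',
    integral_add (h.integrable hf π) (h'.integrable hg π)]
  ring

lemma poisson_sub_kOp (H : OscErgodic K π r) (hg : Measurable g) (h : OscLE g D) (x : E) :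
    poisson K π (fun y ↦ g y - kOp K 1 g y) x = g x - ∫ y, g y ∂π := by
  have := H.isProb_inv
  have hs := H.summable_poisson hg h x
  have hmeas := measurable_kOp H.measurable H.isProb 1 hg
  have hosc := h.kOp H.measurable H.isProb 1 hg
  have e (n : ℕ) : kOp K n (fun y ↦ g y - kOp K 1 g y) x - ∫ y, (g y - kOp K 1 g y) ∂π
      = (kOp K n g x - ∫ y, g y ∂π) - (kOp K (n + 1) g x - ∫ y, g y ∂π) := by
    rw [kOp_sub H.measurable H.isProb n hg h hmeas hosc,
      integral_sub (h.integrable hg π) (hosc.integrable hmeas π), H.integral_kOp hg h,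
      kOp_kOp H.measurable H.isProb n 1 hg h]
    ring
  rw [poisson, tsum_congr e, hs.tsum_sub ((summable_nat_add_iff 1).2 hs), hs.tsum_eq_zero_add,
    kOp_zero hg]
  ring

/-- The partial sums of the Poisson series solve the Poisson equation up to `kOp K N g`. -/
lemma exists_partialSum (H : OscErgodic K π r) (hg : Measurable g) (h : OscLE g D)
    (hr : ∀ n, 0 ≤ r n) (hD : 0 ≤ D) (N : ℕ) :
    ∃ u : E → ℝ, (∀ x, u x = ∑ n ∈ Finset.range N, (kOp K n g x - ∫ y, g y ∂π)) ∧
      Measurable u ∧ OscLE u ((∑' n, r n) * D) ∧ ∫ x, u x ∂π = 0 ∧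
      ∀ x, u x - kOp K 1 u x = g x - kOp K N g x := by
  have := H.isProb_inv
  have hm (n : ℕ) := measurable_kOp H.measurable H.isProb n hg
  have hi (n : ℕ) (μ : Measure E) [IsFiniteMeasure μ] :
      Integrable (fun x ↦ kOp K n g x - ∫ y, g y ∂π) μ :=
    ((H.oscLE g D hg h n).integrable (hm n) μ).sub (integrable_const _)
  refine ⟨fun x ↦ ∑ n ∈ Finset.range N, (kOp K n g x - ∫ y, g y ∂π), fun _ ↦ rfl,
    Finset.measurable_fun_sum _ fun n _ ↦ (hm n).sub_const _, ?_, ?_, fun x ↦ ?_⟩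
  · refine (OscLE.sum (D := fun n ↦ r n * D) _ fun n _ ↦
      (H.oscLE g D hg h n).sub_const _).mono ?_
    rw [← Finset.sum_mul]
    exact mul_le_mul_of_nonneg_right (H.summable.sum_le_tsum _ fun n _ ↦ hr n) hD
  · rw [integral_finsetSum _ fun n _ ↦ hi n π]
    refine Finset.sum_eq_zero fun n _ ↦ ?_
    rw [integral_sub ((H.oscLE g D hg h n).integrable (hm n) π) (integrable_const _),
      H.integral_kOp hg h]
    simp
  · have := H.isProb x
    rw [kOp_one, integral_finsetSum _ fun n _ ↦ hi n (K x), ← Finset.sum_sub_distrib]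
    have e (n : ℕ) : ∫ y, (kOp K n g y - ∫ z, g z ∂π) ∂(K x)
        = kOp K (n + 1) g x - ∫ z, g z ∂π := by
      rw [integral_sub ((H.oscLE g D hg h n).integrable (hm n) _) (integrable_const _),
        ← kOp_one, kOp_kOp H.measurable H.isProb 1 n hg h, add_comm]
      simp
    simp_rw [e, sub_sub_sub_cancel_right]
    rw [Finset.sum_range_sub', kOp_zero hg]

end OscErgodic

/-- Perturbation bound for solutions of the Poisson equation. -/
lemma abs_poisson_sub_le {K' : E → Measure E} {π π' : Measure E} {r : ℕ → ℝ}
    (H : OscErgodic K π r) (H' : OscErgodic K' π' r) (hr : ∀ n, 0 ≤ r n) {a b : ℝ}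
    (ha : ∀ x, tvDist (K x) (K' x) ≤ a) (hb : tvDist π π' ≤ b)
    {f : E → ℝ} {D : ℝ} (hf : Measurable f) (h : OscLE f D) (x : E) :
    |poisson K π f x - poisson K' π' f x|
      ≤ (∑' n, r n) * D * b + (∑' n, r n) * (2 * ((∑' n, r n) * D * a)) := by
  have hE : Nonempty E := ⟨x⟩
  have hD := h.nonneg
  have hS : 0 ≤ (∑' n, r n) * D := mul_nonneg (tsum_nonneg hr) hD
  have := H.isProb_inv
  have := H'.isProb_inv
  set S := ∑' n, r n
  have key (N : ℕ) : |∑ n ∈ Finset.range N, (kOp K n f x - ∫ y, f y ∂π) - poisson K' π' f x|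
      ≤ S * D * b + S * (2 * (S * D * a)) + S * (r N * D) := by
    obtain ⟨u, hu, hum, huo, hu0, hup⟩ := H.exists_partialSum hf h hr hD N
    have hum' := measurable_kOp H.measurable H.isProb 1 hum
    have hum'' := measurable_kOp H'.measurable H'.isProb 1 hum
    have huo' := huo.kOp H'.measurable H'.isProb 1 hum
    have hvm : Measurable fun y ↦ kOp K' 1 u y - kOp K 1 u y := hum''.sub hum'
    have hvo : OscLE (fun y ↦ kOp K' 1 u y - kOp K 1 u y) (2 * (S * D * a)) := by
      refine oscLE_of_abs_le fun y ↦ ?_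
      have := H.isProb y
      have := H'.isProb y
      rw [kOp_one, kOp_one, abs_sub_comm]
      exact (abs_integral_sub_integral_le_tvDist _ _ hum huo).trans
        (mul_le_mul_of_nonneg_left (ha y) hS)
    have hwm := measurable_kOp H.measurable H.isProb N hf
    have hwo := H.oscLE f D hf h N
    have hdo : OscLE (fun y ↦ u y - kOp K' 1 u y) (S * D + S * D) := fun y z ↦ by
      have := huo y z
      have := huo' z y
      linarith
    have hsplit : f = fun y ↦ (u y - kOp K' 1 u y) +
        ((kOp K' 1 u y - kOp K 1 u y) + kOp K N f y) := by
      funext y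
      have := hup y
      linarith
    have hval : poisson K' π' f x = (u x - ∫ y, u y ∂π') +
        (poisson K' π' (fun y ↦ kOp K' 1 u y - kOp K 1 u y) x +
          poisson K' π' (kOp K N f) x) := by
      conv_lhs => rw [hsplit]
      have hm₁ : Measurable fun y ↦ u y - kOp K' 1 u y := hum.sub hum''
      have hm₂ : Measurable fun y ↦ (kOp K' 1 u y - kOp K 1 u y) + kOp K N f y := hvm.add hwm
      rw [H'.poisson_add hm₁ hdo hm₂ (hvo.add hwo), H'.poisson_add hvm hvo hwm hwo,
        H'.poisson_sub_kOp hum huo]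
    have h1 := abs_le.1 (H'.abs_poisson_le hvm hvo x)
    have h2 := abs_le.1 (H'.abs_poisson_le hwm hwo x)
    have h3 := abs_le.1 ((abs_integral_sub_integral_le_tvDist π π' hum huo).trans
        (mul_le_mul_of_nonneg_left hb hS))
    rw [hu0] at h3
    rw [← hu x, hval, abs_le]
    constructor <;> linarith
  have t1 := (H.summable_poisson hf h x).hasSum.tendsto_sum_nat
  have t2 := (((H.summable.tendsto_atTop_zero.mul_const D).const_mul S).const_add
    (S * D * b + S * (2 * (S * D * a))))
  rw [zero_mul, mul_zero, add_zero] at t2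
  exact le_of_tendsto_of_tendsto' (t1.sub_const _).abs t2 key

end QSD

/-- Lemma 3.4 (b): under (P0), (P1), (P2), the solution of the Poisson
equation is Lipschitz in `μ` for the total variation norm:
`‖Q_μ f − Q_ν f‖_∞ ≤ C ‖f‖_∞ ‖μ − ν‖_TV`. -/
theorem stmt8
    {E : Type*} [MeasurableSpace E]
    (Kb : ProbabilityMeasure E → E → Measure E)
    (hKmeas : ∀ μ, Measurable (Kb μ))
    (hKmarkov : ∀ μ x, IsProbabilityMeasure (Kb μ x))
    -- (P0)
    (Pi : ProbabilityMeasure E → ProbabilityMeasure E)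
    (hPiInv : ∀ μ, ((Pi μ : Measure E)).bind (Kb μ) = (Pi μ : Measure E))
    (hPiUniq : ∀ (μ : ProbabilityMeasure E) (π : Measure E), IsProbabilityMeasure π →
      π.bind (Kb μ) = π → π = (Pi μ : Measure E))
    (L : ℝ)
    (hPiLip : ∀ μ ν : ProbabilityMeasure E,
      tvDist (Pi μ : Measure E) (Pi ν : Measure E)
        ≤ L * tvDist (μ : Measure E) (ν : Measure E))
    -- (P1)
    (ℓ : ℕ) (hℓ : 1 ≤ ℓ) (ε : ℝ≥0∞) (hε0 : 0 < ε) (hε1 : ε < 1)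
    (Ψ : Measure E) (hΨ : IsProbabilityMeasure Ψ)
    (hP1 : ∀ (μ : ProbabilityMeasure E) (x : E) (A : Set E), MeasurableSet A →
      ε * Ψ A ≤ kIter (Kb μ) ℓ x A)
    -- (P2)
    (c₂ : ℝ) (hc₂ : 0 < c₂)
    (hP2 : ∀ (μ ν : ProbabilityMeasure E) (x : E),
      tvDist (Kb μ x) (Kb ν x) ≤ c₂ * tvDist (μ : Measure E) (ν : Measure E)) :
    ∃ C : ℝ, ∀ (μ ν : ProbabilityMeasure E) (f : E → ℝ), Measurable f →
      ∀ Mf : ℝ, (∀ x, |f x| ≤ Mf) →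
      ∀ x : E, |Qfun Kb Pi μ f x - Qfun Kb Pi ν f x|
        ≤ C * Mf * tvDist (μ : Measure E) (ν : Measure E) := by
  have hεt : 0 < ε.toReal := ENNReal.toReal_pos hε0.ne' hε1.ne_top
  have hε1t : ε.toReal < 1 := by
    simpa using (ENNReal.toReal_lt_toReal hε1.ne_top ENNReal.one_ne_top).2 hε1
  set ρ : ℝ := 1 - ε.toReal
  have hρ0 : 0 ≤ ρ := by linarith
  have hρ1 : ρ < 1 := by linarith
  set r : ℕ → ℝ := fun n ↦ ρ ^ (n / ℓ)
  have hr : ∀ n, 0 ≤ r n := fun n ↦ pow_nonneg hρ0 _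
  have H (μ : ProbabilityMeasure E) : OscErgodic (Kb μ) (Pi μ : Measure E) r :=
    { measurable := hKmeas μ
      isProb := hKmarkov μ
      isProb_inv := inferInstance
      invariant := hPiInv μ
      oscLE := fun g D hg h n ↦ by
        have := OscLE.kOp_pow (hKmeas μ) (hKmarkov μ) (fun g' D' hg' h' ↦
          h'.kOp_of_minorization (hKmeas μ) (hKmarkov μ) hΨ (hP1 μ) hg') hg h
          (n / ℓ) (n % ℓ)
        rwa [Nat.div_add_mod] at this
      summable := summable_pow_div hρ0 hρ1 hℓ }
  refine ⟨2 * (∑' n, r n) * L + 4 * (∑' n, r n) ^ 2 * c₂, fun μ ν f hf Mf hM x ↦ ?_⟩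
  refine (abs_poisson_sub_le (H μ) (H ν) hr (hP2 μ ν) (hPiLip μ ν) hf
    (oscLE_of_abs_le hM) x).trans_eq ?_
  ring
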